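/- Let f : [0,∞) → [0,∞) be a convex function with f(0) = 0, let P = {P_1,…,P_m} be a system of coordinate projections in M_n(ℂ), let W ∈ M_n(ℂ) be a contraction, and let A, B ∈ M_n(ℂ) be positive semidefinite with C_P(W*BW) = A. Then there exists a contraction W̃ ∈ M_n(ℂ) such that C_P(W̃*f(B)W̃) = f(A). -/

import Mathlib

open Matrix
open scoped ComplexOrder

/-- `V` is a contraction: its operator norm on `ℓ²` is at most 1. -/
noncomputable def IsContraction {ι : Type*} [Fintype ι] [DecidableEq ι]
    (V : Matrix ι ι ℂ) : Prop :=
  ∀ x : EuclideanSpace ℂ ι, ‖Matrix.toEuclideanLin V x‖ ≤ ‖x‖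

/-- The `i`-th coordinate projection of the system encoded by the block-index
function `g : Fin n → Fin m` (monotone and surjective `g` corresponds to a
partition of `{1,…,n}` into `m` consecutive intervals). -/
def coordProj {n m : ℕ} (g : Fin n → Fin m) (i : Fin m) :
    Matrix (Fin n) (Fin n) ℂ :=
  Matrix.diagonal fun k => if g k = i then 1 else 0

/-- The compression `C_P(X) = Σ_i P_i X P_i` induced by the system of
coordinate projections encoded by `g`. -/
noncomputable def coordCompress {n m : ℕ} (g : Fin n → Fin m)
    (X : Matrix (Fin n) (Fin n) ℂ) : Matrix (Fin n) (Fin n) ℂ :=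
  ∑ i : Fin m, coordProj g i * X * coordProj g i

/-- The nonincreasing rearrangement `x↓` of a vector `x ∈ ℝ^n`. -/
noncomputable def sortedVec {n : ℕ} (x : Fin n → ℝ) : Fin n → ℝ :=
  fun i => ((Multiset.map x Finset.univ.val).sort (· ≥ ·)).get (Fin.cast (by simp) i)

/-- Vector majorization `x ≺ y`. -/
noncomputable def Majorizes {n : ℕ} (x y : Fin n → ℝ) : Prop :=
  (∀ k : ℕ, k ≤ n →
      ∑ i ∈ Finset.univ.filter (fun i : Fin n => (i : ℕ) < k), sortedVec x i ≤
        ∑ i ∈ Finset.univ.filter (fun i : Fin n => (i : ℕ) < k), sortedVec y i) ∧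
    ∑ i, x i = ∑ i, y i

/-- `f(A)` for a hermitian matrix `A`, via the spectral theorem. -/
noncomputable def matFun {n : ℕ} {A : Matrix (Fin n) (Fin n) ℂ}
    (hA : A.IsHermitian) (f : ℝ → ℝ) : Matrix (Fin n) (Fin n) ℂ :=
  (hA.eigenvectorUnitary : Matrix (Fin n) (Fin n) ℂ) *
    Matrix.diagonal (fun i => (f (hA.eigenvalues i) : ℂ)) *
    star (hA.eigenvectorUnitary : Matrix (Fin n) (Fin n) ℂ)

/-- The squared `ℓ²`-norm of a complex vector. -/
noncomputable def normSqSum {n : ℕ} (x : Fin n → ℂ) : ℝ := ∑ k, ‖x k‖ ^ 2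

lemma isContraction_iff_normSqSum {n : ℕ} (V : Matrix (Fin n) (Fin n) ℂ) :
    IsContraction V ↔ ∀ x : Fin n → ℂ, normSqSum (V *ᵥ x) ≤ normSqSum x := by
  have key (x : EuclideanSpace ℂ (Fin n)) : ‖Matrix.toEuclideanLin V x‖ ≤ ‖x‖ ↔
      normSqSum (V *ᵥ x.ofLp) ≤ normSqSum x.ofLp := by
    rw [← sq_le_sq₀ (norm_nonneg _) (norm_nonneg _), EuclideanSpace.norm_sq_eq,
      EuclideanSpace.norm_sq_eq]
    rfl
  constructor
  · intro h x
    exact (key (WithLp.toLp 2 x)).1 (h _)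
  · intro h x
    exact (key x).2 (h _)

lemma IsContraction.mul {n : ℕ} {V W : Matrix (Fin n) (Fin n) ℂ}
    (hV : IsContraction V) (hW : IsContraction W) : IsContraction (V * W) := by
  rw [isContraction_iff_normSqSum] at *
  intro x
  rw [← mulVec_mulVec]
  exact (hV _).trans (hW _)

lemma normSqSum_eq_dotProduct {n : ℕ} (x : Fin n → ℂ) : (normSqSum x : ℂ) = star x ⬝ᵥ x := by
  simp [normSqSum, dotProduct, Complex.conj_mul']

lemma normSqSum_mulVec_of_star_mul_self {n : ℕ} {U : Matrix (Fin n) (Fin n) ℂ}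
    (hU : star U * U = 1) (x : Fin n → ℂ) : normSqSum (U *ᵥ x) = normSqSum x := by
  have h : (normSqSum (U *ᵥ x) : ℂ) = normSqSum x := by
    rw [normSqSum_eq_dotProduct, normSqSum_eq_dotProduct, star_mulVec, dotProduct_mulVec,
      vecMul_vecMul, ← star_eq_conjTranspose, hU, vecMul_one]
  exact_mod_cast h

lemma isContraction_of_star_mul_self {n : ℕ} {U : Matrix (Fin n) (Fin n) ℂ}
    (hU : star U * U = 1) : IsContraction U :=
  (isContraction_iff_normSqSum U).2 fun x => (normSqSum_mulVec_of_star_mul_self hU x).le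

lemma isContraction_diagonal {n : ℕ} {d : Fin n → ℂ} (hd : ∀ k, ‖d k‖ ≤ 1) :
    IsContraction (diagonal d) := by
  rw [isContraction_iff_normSqSum]
  intro x
  refine Finset.sum_le_sum fun k _ => ?_
  rw [mulVec_diagonal, norm_mul]
  gcongr
  exact mul_le_of_le_one_left (norm_nonneg _) (hd k)

/-- The quadratic form `x ↦ Re ⟨x, X x⟩`. -/
noncomputable def quadForm {n : ℕ} (X : Matrix (Fin n) (Fin n) ℂ) (x : Fin n → ℂ) : ℝ :=
  (star x ⬝ᵥ X *ᵥ x).re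

lemma quadForm_conj {n : ℕ} (X V : Matrix (Fin n) (Fin n) ℂ) (x : Fin n → ℂ) :
    quadForm (Vᴴ * X * V) x = quadForm X (V *ᵥ x) := by
  simp only [quadForm, star_mulVec, ← mulVec_mulVec, dotProduct_mulVec, vecMul_vecMul]

lemma quadForm_diagonal {n : ℕ} (d : Fin n → ℝ) (x : Fin n → ℂ) :
    quadForm (diagonal fun i => (d i : ℂ)) x = ∑ k, ‖x k‖ ^ 2 * d k := by
  have h : (star x ⬝ᵥ (diagonal fun i => (d i : ℂ)) *ᵥ x) = ((∑ k, ‖x k‖ ^ 2 * d k : ℝ) : ℂ) := by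
    simp only [dotProduct, mulVec_diagonal, Pi.star_apply, Complex.ofReal_sum, Complex.ofReal_mul,
      Complex.ofReal_pow, RCLike.star_def]
    refine Finset.sum_congr rfl fun k _ => ?_
    rw [← Complex.conj_mul']
    ring
  rw [quadForm, h, Complex.ofReal_re]

/-- The coordinates of `x` in the eigenvector basis of a hermitian matrix. -/
noncomputable def eigenCoord {n : ℕ} {A : Matrix (Fin n) (Fin n) ℂ} (hA : A.IsHermitian)
    (x : Fin n → ℂ) : Fin n → ℂ :=
  star (hA.eigenvectorUnitary : Matrix (Fin n) (Fin n) ℂ) *ᵥ x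

lemma normSqSum_eigenCoord {n : ℕ} {A : Matrix (Fin n) (Fin n) ℂ} (hA : A.IsHermitian)
    (x : Fin n → ℂ) : normSqSum (eigenCoord hA x) = normSqSum x :=
  normSqSum_mulVec_of_star_mul_self (by simp) x

lemma matFun_id {n : ℕ} {A : Matrix (Fin n) (Fin n) ℂ} (hA : A.IsHermitian) :
    matFun hA (fun t => t) = A := by
  conv_rhs => rw [hA.spectral_theorem]
  rfl

lemma quadForm_matFun {n : ℕ} {A : Matrix (Fin n) (Fin n) ℂ} (hA : A.IsHermitian) (f : ℝ → ℝ)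
    (x : Fin n → ℂ) :
    quadForm (matFun hA f) x = ∑ k, ‖eigenCoord hA x k‖ ^ 2 * f (hA.eigenvalues k) := by
  have h := quadForm_conj (diagonal fun i => (f (hA.eigenvalues i) : ℂ))
    (star (hA.eigenvectorUnitary : Matrix (Fin n) (Fin n) ℂ)) x
  rw [quadForm_diagonal, ← star_eq_conjTranspose, star_star] at h
  exact h

lemma quadForm_eq_sum_eigenvalues {n : ℕ} {A : Matrix (Fin n) (Fin n) ℂ} (hA : A.IsHermitian)
    (x : Fin n → ℂ) :
    quadForm A x = ∑ k, ‖eigenCoord hA x k‖ ^ 2 * hA.eigenvalues k := by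
  rw [← quadForm_matFun hA (fun t => t), matFun_id]

lemma isHermitian_matFun {n : ℕ} {A : Matrix (Fin n) (Fin n) ℂ} (hA : A.IsHermitian)
    (f : ℝ → ℝ) : (matFun hA f).IsHermitian := by
  simp only [IsHermitian, matFun, star_eq_conjTranspose, conjTranspose_mul, diagonal_conjTranspose,
    conjTranspose_conjTranspose, mul_assoc]
  congr 3
  ext i
  simp

/-- Functional calculus respects intertwining relations. -/
lemma matFun_mul_eq_mul_matFun {n : ℕ} {A X Z : Matrix (Fin n) (Fin n) ℂ} (hA : A.IsHermitian)
    (hX : X.IsHermitian) (f : ℝ → ℝ) (h : A * Z = Z * X) :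
    matFun hA f * Z = Z * matFun hX f := by
  set U := (hA.eigenvectorUnitary : Matrix (Fin n) (Fin n) ℂ) with hU
  set V := (hX.eigenvectorUnitary : Matrix (Fin n) (Fin n) ℂ) with hV
  have hU1 : star U * U = 1 := by simp [hU]
  have hU2 : U * star U = 1 := by simp [hU]
  have hV1 : star V * V = 1 := by simp [hV]
  have hV2 : V * star V = 1 := by simp [hV]
  have left_eq (D : Matrix (Fin n) (Fin n) ℂ) :
      star U * (U * D * star U * Z) * V = D * (star U * Z * V) := by
    simp only [← mul_assoc, hU1, one_mul]
  have right_eq (D : Matrix (Fin n) (Fin n) ℂ) :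
      star U * (Z * (V * D * star V)) * V = (star U * Z * V) * D := by
    simp only [mul_assoc, hV1, mul_one]
  have hdiag : diagonal (fun i => (hA.eigenvalues i : ℂ)) * (star U * Z * V) =
      (star U * Z * V) * diagonal (fun i => (hX.eigenvalues i : ℂ)) := by
    rw [← left_eq, ← right_eq]
    have h1 := matFun_id hA
    have h2 := matFun_id hX
    simp only [matFun, ← hU, ← hV] at h1 h2
    rw [h1, h2, h]
  have hdiag' : diagonal (fun i => (f (hA.eigenvalues i) : ℂ)) * (star U * Z * V) =
      (star U * Z * V) * diagonal (fun i => (f (hX.eigenvalues i) : ℂ)) := by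
    ext i j
    have hij := congrFun (congrFun hdiag i) j
    rw [diagonal_mul, mul_diagonal] at hij ⊢
    by_cases hz : (star U * Z * V) i j = 0
    · simp [hz]
    · rw [mul_comm] at hij
      have := Complex.ofReal_injective (mul_left_cancel₀ hz hij)
      rw [this, mul_comm]
  rw [← left_eq, ← right_eq] at hdiag'
  have cancel (Y : Matrix (Fin n) (Fin n) ℂ) : U * (star U * Y * V) * star V = Y := by
    rw [mul_assoc, mul_assoc _ V, hV2, mul_one, ← mul_assoc, hU2, one_mul]
  have := congrArg (fun Y => U * Y * star V) hdiag'
  simp only [cancel] at this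
  exact this

lemma ConvexOn.monotoneOn_of_map_zero {f : ℝ → ℝ} (hf_nonneg : ∀ x : ℝ, 0 ≤ x → 0 ≤ f x)
    (hf_conv : ConvexOn ℝ (Set.Ici (0 : ℝ)) f) (hf0 : f 0 = 0) :
    MonotoneOn f (Set.Ici (0 : ℝ)) := by
  intro x hx y hy hxy
  rcases (Set.mem_Ici.1 hy).eq_or_lt with rfl | hy0
  · rw [le_antisymm hxy hx]
  have hx0 : 0 ≤ x / y := div_nonneg hx hy
  have hx1 : x / y ≤ 1 := (div_le_one hy0).2 hxy
  have h := hf_conv.2 hy Set.self_mem_Ici hx0 (sub_nonneg.2 hx1) (by ring)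
  simp only [smul_eq_mul, hf0, mul_zero, add_zero, div_mul_cancel₀ x hy0.ne'] at h
  exact h.trans (mul_le_of_le_one_left (hf_nonneg y hy) hx1)

/-- Jensen's inequality for quadratic forms and vectors in the unit ball. -/
lemma map_quadForm_le_quadForm_matFun {n : ℕ} {f : ℝ → ℝ}
    (hf_conv : ConvexOn ℝ (Set.Ici (0 : ℝ)) f) (hf0 : f 0 = 0)
    {B : Matrix (Fin n) (Fin n) ℂ} (hB : B.PosSemidef) {x : Fin n → ℂ} (hx : normSqSum x ≤ 1) :
    f (quadForm B x) ≤ quadForm (matFun hB.1 f) x := by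
  rw [quadForm_matFun, quadForm_eq_sum_eigenvalues hB.1]
  have hw : ∑ k, ‖eigenCoord hB.1 x k‖ ^ 2 ≤ 1 := (normSqSum_eigenCoord hB.1 x).trans_le hx
  have h := hf_conv.map_add_sum_le (t := Finset.univ) (q := 0)
    (v := 1 - ∑ k, ‖eigenCoord hB.1 x k‖ ^ 2) (w := fun k => ‖eigenCoord hB.1 x k‖ ^ 2)
    (p := hB.1.eigenvalues) (fun k _ => by positivity) (by ring)
    (fun k _ => hB.eigenvalues_nonneg k) (sub_nonneg.2 hw) Set.self_mem_Ici
  simpa [hf0] using h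

/-- A vector avoiding, for a given ordering of the indices, the coordinates after `j` in one
basis and those before `j` in another one. -/
lemma exists_normSqSum_eq_one {n : ℕ} (S T : Matrix (Fin n) (Fin n) ℂ) (j : Fin n)
    (p : Fin n → Prop) :
    ∃ x : Fin n → ℂ, normSqSum x = 1 ∧
      ∀ k, k ≠ j → (p k → (S *ᵥ x) k = 0) ∧ (¬ p k → (T *ᵥ x) k = 0) := by
  classical
  let L : (Fin n → ℂ) →ₗ[ℂ] ({k : Fin n // k ≠ j} → ℂ) :=
    LinearMap.pi fun k => LinearMap.proj k.1 ∘ₗ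
      (if p k.1 then Matrix.toLin' S else Matrix.toLin' T)
  have hL : LinearMap.ker L ≠ ⊥ := by
    apply LinearMap.ker_ne_bot_of_finrank_lt
    rw [Module.finrank_pi, Module.finrank_pi]
    exact Fintype.card_subtype_lt (x := j) (by simp)
  obtain ⟨x, hxL, hx0⟩ := (Submodule.ne_bot_iff _).1 hL
  have hpos : 0 < normSqSum x := by
    obtain ⟨k, hk⟩ := Function.ne_iff.1 hx0
    refine Finset.sum_pos' (fun _ _ => by positivity) ⟨k, Finset.mem_univ _, ?_⟩
    have : x k ≠ 0 := hk
    positivity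
  refine ⟨(((Real.sqrt (normSqSum x))⁻¹ : ℝ) : ℂ) • x, ?_, fun k hk => ?_⟩
  · have : normSqSum ((((Real.sqrt (normSqSum x))⁻¹ : ℝ) : ℂ) • x) =
        ((Real.sqrt (normSqSum x)) ^ 2)⁻¹ * normSqSum x := by
      simp only [normSqSum, Pi.smul_apply, smul_eq_mul, norm_mul, Complex.norm_real, mul_pow,
        Finset.mul_sum, Real.norm_eq_abs, sq_abs, inv_pow]
    rw [this, Real.sq_sqrt hpos.le, inv_mul_cancel₀ hpos.ne']
  · have hk' : L x ⟨k, hk⟩ = 0 := by rw [LinearMap.mem_ker.1 hxL]; rfl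
    simp only [mulVec_smul, Pi.smul_apply, smul_eq_mul]
    constructor <;> intro hp <;> simp [L, hp] at hk' <;> simp [hk']

lemma map_eigenvalues_le_eigenvalues {n : ℕ} {f : ℝ → ℝ} (hf : MonotoneOn f (Set.Ici (0 : ℝ)))
    {X Y : Matrix (Fin n) (Fin n) ℂ} (hX : X.PosSemidef) (hY : Y.IsHermitian)
    (h : ∀ x, normSqSum x = 1 → f (quadForm X x) ≤ quadForm Y x) (j : Fin n) :
    f (hX.1.eigenvalues j) ≤ hY.eigenvalues j := by
  let e : Fin n ≃ Fin (Fintype.card (Fin n)) := (Fintype.equivOfCardEq (Fintype.card_fin _)).symm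
  have hXe {k l : Fin n} (hkl : e k ≤ e l) : hX.1.eigenvalues l ≤ hX.1.eigenvalues k :=
    hX.1.eigenvalues₀_antitone hkl
  have hYe {k l : Fin n} (hkl : e k ≤ e l) : hY.eigenvalues l ≤ hY.eigenvalues k :=
    hY.eigenvalues₀_antitone hkl
  obtain ⟨x, hx1, hx⟩ := exists_normSqSum_eq_one
    (star (hX.1.eigenvectorUnitary : Matrix (Fin n) (Fin n) ℂ))
    (star (hY.eigenvectorUnitary : Matrix (Fin n) (Fin n) ℂ)) j (fun k => e j < e k)
  have hXx : hX.1.eigenvalues j ≤ quadForm X x := by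
    have hs := normSqSum_eigenCoord hX.1 x
    rw [hx1, normSqSum] at hs
    rw [quadForm_eq_sum_eigenvalues hX.1, ← one_mul (hX.1.eigenvalues j), ← hs, Finset.sum_mul]
    refine Finset.sum_le_sum fun k _ => ?_
    by_cases hk : e j < e k
    · have : eigenCoord hX.1 x k = 0 := (hx k (by rintro rfl; exact lt_irrefl _ hk)).1 hk
      simp [this]
    · exact mul_le_mul_of_nonneg_left (hXe (not_lt.1 hk)) (by positivity)
  have hYx : quadForm Y x ≤ hY.eigenvalues j := by
    have hs := normSqSum_eigenCoord hY x
    rw [hx1, normSqSum] at hs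
    rw [quadForm_eq_sum_eigenvalues hY, ← one_mul (hY.eigenvalues j), ← hs, Finset.sum_mul]
    refine Finset.sum_le_sum fun k _ => ?_
    by_cases hk : e j ≤ e k
    · exact mul_le_mul_of_nonneg_left (hYe hk) (by positivity)
    · have : eigenCoord hY x k = 0 :=
        (hx k (by rintro rfl; exact hk le_rfl)).2 fun h' => hk h'.le
      simp [this]
  have h0 : 0 ≤ hX.1.eigenvalues j := hX.eigenvalues_nonneg j
  exact (hf h0 (h0.trans hXx) hXx).trans ((h x hx1).trans hYx)

lemma exists_isContraction_conj_eq_matFun {n : ℕ} {f : ℝ → ℝ}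
    {X Y : Matrix (Fin n) (Fin n) ℂ} (hX : X.IsHermitian) (hY : Y.IsHermitian)
    (h0 : ∀ j, 0 ≤ f (hX.eigenvalues j)) (h : ∀ j, f (hX.eigenvalues j) ≤ hY.eigenvalues j) :
    ∃ K : Matrix (Fin n) (Fin n) ℂ, IsContraction K ∧ Kᴴ * Y * K = matFun hX f := by
  set U := (hX.eigenvectorUnitary : Matrix (Fin n) (Fin n) ℂ) with hU
  set V := (hY.eigenvectorUnitary : Matrix (Fin n) (Fin n) ℂ) with hV
  have hU2 : U * star U = 1 := by simp [hU]
  have hV1 : star V * V = 1 := by simp [hV]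
  let d : Fin n → ℝ := fun j => Real.sqrt (f (hX.eigenvalues j) / hY.eigenvalues j)
  let D : Matrix (Fin n) (Fin n) ℂ := diagonal fun j => (d j : ℂ)
  have hDH : Dᴴ = D := by
    simp only [D, diagonal_conjTranspose]
    congr 1
    ext i
    simp
  have hD : IsContraction D := by
    refine isContraction_diagonal fun j => ?_
    rw [Complex.norm_real, Real.norm_of_nonneg (Real.sqrt_nonneg _), Real.sqrt_le_one]
    exact div_le_one_of_le₀ (h j) ((h0 j).trans (h j))
  have hDD : D * diagonal (fun j => (hY.eigenvalues j : ℂ)) * D =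
      diagonal fun j => (f (hX.eigenvalues j) : ℂ) := by
    simp only [D, diagonal_mul_diagonal]
    congr 1
    ext j
    rw [← Complex.ofReal_mul, ← Complex.ofReal_mul, mul_right_comm,
      Real.mul_self_sqrt (div_nonneg (h0 j) ((h0 j).trans (h j)))]
    rcases ((h0 j).trans (h j)).eq_or_lt with hj | hj
    · have : f (hX.eigenvalues j) = 0 := le_antisymm ((h j).trans hj.ge) (h0 j)
      simp [this]
    · rw [div_mul_cancel₀ _ hj.ne']
  refine ⟨V * D * star U, ((isContraction_of_star_mul_self hV1).mul hD).mul
    (isContraction_of_star_mul_self (by rw [star_star, hU2])), ?_⟩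
  have hYV := matFun_id hY
  simp only [matFun, ← hV] at hYV
  conv_lhs => rw [← hYV]
  rw [conjTranspose_mul, conjTranspose_mul, hDH, ← star_eq_conjTranspose, ← star_eq_conjTranspose,
    star_star, matFun, ← hDD]
  calc _ = U * (D * (star V * V) * diagonal (fun j => (hY.eigenvalues j : ℂ)) * (star V * V) * D)
        * star U := by simp only [mul_assoc]
    _ = _ := by rw [hV1, mul_one, mul_one]

/-- A convex functional calculus of a compression `Vᴴ B V` is itself a compression of
`Vᴴ f(B) V`. -/
lemma exists_isContraction_matFun_conj {n : ℕ} {f : ℝ → ℝ}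
    (hf_nonneg : ∀ x : ℝ, 0 ≤ x → 0 ≤ f x)
    (hf_conv : ConvexOn ℝ (Set.Ici (0 : ℝ)) f) (hf0 : f 0 = 0)
    {B V : Matrix (Fin n) (Fin n) ℂ} (hB : B.PosSemidef) (hV : IsContraction V)
    (hX : (Vᴴ * B * V).IsHermitian) :
    ∃ K : Matrix (Fin n) (Fin n) ℂ, IsContraction K ∧
      Kᴴ * (Vᴴ * matFun hB.1 f * V) * K = matFun hX f := by
  have hX' : (Vᴴ * B * V).PosSemidef := hB.conjTranspose_mul_mul_same V
  have hY : (Vᴴ * matFun hB.1 f * V).IsHermitian :=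
    isHermitian_conjTranspose_mul_mul V (isHermitian_matFun hB.1 f)
  refine exists_isContraction_conj_eq_matFun hX hY
    (fun j => hf_nonneg _ (hX'.eigenvalues_nonneg j)) fun j => ?_
  refine map_eigenvalues_le_eigenvalues
    (ConvexOn.monotoneOn_of_map_zero hf_nonneg hf_conv hf0) hX' hY (fun x hx => ?_) j
  rw [quadForm_conj, quadForm_conj]
  exact map_quadForm_le_quadForm_matFun hf_conv hf0 hB
    (((isContraction_iff_normSqSum V).1 hV x).trans hx.le)

lemma coordProj_conjTranspose {n m : ℕ} (g : Fin n → Fin m) (i : Fin m) :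
    (coordProj g i)ᴴ = coordProj g i := by
  rw [coordProj, diagonal_conjTranspose]
  congr 1
  ext k
  simp only [Pi.star_apply]
  split_ifs <;> simp

lemma coordProj_mul_coordProj {n m : ℕ} (g : Fin n → Fin m) (i j : Fin m) :
    coordProj g i * coordProj g j = if i = j then coordProj g i else 0 := by
  ext k l
  simp only [coordProj, diagonal_mul_diagonal]
  by_cases hij : i = j <;> by_cases hkl : k = l
  · simp [hij, hkl]
  · simp [hij, hkl]
  · subst hkl
    by_cases hi : g k = i
    · simp [hij, hi]
    · simp [hij, hi]
  · simp [hij, hkl]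

lemma sum_coordProj {n m : ℕ} (g : Fin n → Fin m) : ∑ i, coordProj g i = 1 := by
  ext k l
  simp [coordProj, Matrix.sum_apply, diagonal_apply, one_apply]

lemma isContraction_coordProj {n m : ℕ} (g : Fin n → Fin m) (i : Fin m) :
    IsContraction (coordProj g i) :=
  isContraction_diagonal fun k => by split_ifs <;> simp

/-- The block-diagonal matrix whose `i`-th block is the `i`-th diagonal block of `K i`. -/
noncomputable def blockSum {n m : ℕ} (g : Fin n → Fin m)
    (K : Fin m → Matrix (Fin n) (Fin n) ℂ) : Matrix (Fin n) (Fin n) ℂ :=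
  ∑ i, coordProj g i * K i * coordProj g i

lemma blockSum_mul_coordProj {n m : ℕ} (g : Fin n → Fin m)
    (K : Fin m → Matrix (Fin n) (Fin n) ℂ) (i : Fin m) :
    blockSum g K * coordProj g i = coordProj g i * K i * coordProj g i := by
  simp [blockSum, Finset.sum_mul, mul_assoc, coordProj_mul_coordProj]

lemma normSqSum_eq_sum_coordProj {n m : ℕ} (g : Fin n → Fin m) (x : Fin n → ℂ) :
    normSqSum x = ∑ i, normSqSum (coordProj g i *ᵥ x) := by
  simp only [normSqSum]
  rw [Finset.sum_comm]
  refine Finset.sum_congr rfl fun k _ => ?_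
  rw [Finset.sum_eq_single (g k)]
  · simp [coordProj, mulVec_diagonal]
  · intro i _ hi
    simp [coordProj, mulVec_diagonal, hi.symm]
  · simp

lemma isContraction_blockSum {n m : ℕ} (g : Fin n → Fin m)
    {K : Fin m → Matrix (Fin n) (Fin n) ℂ} (hK : ∀ i, IsContraction (K i)) :
    IsContraction (blockSum g K) := by
  rw [isContraction_iff_normSqSum]
  intro x
  rw [normSqSum_eq_sum_coordProj g, normSqSum_eq_sum_coordProj g x]
  refine Finset.sum_le_sum fun i _ => ?_
  have h : coordProj g i * blockSum g K = coordProj g i * K i * coordProj g i := by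
    simp [blockSum, Finset.mul_sum, ← mul_assoc, coordProj_mul_coordProj]
  rw [mulVec_mulVec, h, ← mulVec_mulVec]
  exact (isContraction_iff_normSqSum _).1 ((isContraction_coordProj g i).mul (hK i)) _

lemma coordCompress_mul_coordProj {n m : ℕ} (g : Fin n → Fin m)
    (X : Matrix (Fin n) (Fin n) ℂ) (i : Fin m) :
    coordCompress g X * coordProj g i = coordProj g i * X * coordProj g i :=
  blockSum_mul_coordProj g (fun _ => X) i


/-- monotonicity of extended submajorization under convex
functions vanishing at 0: if `C_P(W*BW) = A` for a contraction `W`, then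
`C_P(W̃* f(B) W̃) = f(A)` for some contraction `W̃`. -/
theorem stmt_14 {n m : ℕ} (f : ℝ → ℝ)
    (hf_nonneg : ∀ x : ℝ, 0 ≤ x → 0 ≤ f x)
    (hf_conv : ConvexOn ℝ (Set.Ici (0 : ℝ)) f) (hf0 : f 0 = 0)
    (g : Fin n → Fin m) (hg_mono : Monotone g) (hg_surj : Function.Surjective g)
    (W : Matrix (Fin n) (Fin n) ℂ) (hW : IsContraction W)
    (A B : Matrix (Fin n) (Fin n) ℂ) (hA : A.PosSemidef) (hB : B.PosSemidef)
    (h : coordCompress g (Wᴴ * B * W) = A) :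
    ∃ W' : Matrix (Fin n) (Fin n) ℂ, IsContraction W' ∧
      coordCompress g (W'ᴴ * matFun hB.1 f * W') = matFun hA.1 f := by
  have hX (i : Fin m) : ((W * coordProj g i)ᴴ * B * (W * coordProj g i)).IsHermitian :=
    isHermitian_conjTranspose_mul_mul _ hB.1
  choose K hK hKX using fun i => exists_isContraction_matFun_conj hf_nonneg hf_conv hf0 hB
    (hW.mul (isContraction_coordProj g i)) (hX i)
  have hPP (i : Fin m) : coordProj g i * coordProj g i = coordProj g i := by
    simp [coordProj_mul_coordProj]
  refine ⟨W * blockSum g K, hW.mul (isContraction_blockSum g hK), ?_⟩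
  have hblock (i : Fin m) : coordProj g i *
      ((W * blockSum g K)ᴴ * matFun hB.1 f * (W * blockSum g K)) * coordProj g i =
      matFun hA.1 f * coordProj g i := by
    have hright := blockSum_mul_coordProj g K i
    have hleft : coordProj g i * (blockSum g K)ᴴ = coordProj g i * (K i)ᴴ * coordProj g i := by
      have := congrArg conjTranspose hright
      simpa only [conjTranspose_mul, coordProj_conjTranspose, ← mul_assoc] using this
    have hAX : A * coordProj g i =
        coordProj g i * ((W * coordProj g i)ᴴ * B * (W * coordProj g i)) := by
      rw [← h, coordCompress_mul_coordProj, conjTranspose_mul, coordProj_conjTranspose]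
      simp only [← mul_assoc, hPP]
    calc _ = (coordProj g i * (blockSum g K)ᴴ) * (Wᴴ * matFun hB.1 f * W) *
          (blockSum g K * coordProj g i) := by simp only [conjTranspose_mul, mul_assoc]
      _ = coordProj g i * ((K i)ᴴ * ((W * coordProj g i)ᴴ * matFun hB.1 f *
          (W * coordProj g i)) * K i) * coordProj g i := by
        rw [hleft, hright, conjTranspose_mul, coordProj_conjTranspose]
        simp only [mul_assoc]
      _ = _ := by
        rw [hKX, ← matFun_mul_eq_mul_matFun hA.1 (hX i) f hAX, mul_assoc, hPP]
  rw [coordCompress, Finset.sum_congr rfl fun i _ => hblock i, ← Finset.mul_sum, sum_coordProj,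
    mul_one]
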